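/- There exists a constant c > 0 such that the following holds for all m ≥ 2. Let N ≥ m·log m, s = ⌈m·log m⌉, B = (m+3)/3, and ℓ = 7. Draw x_1, …, x_N ∈ ℝ^m independently from an arbitrary mixture of two Gaussian distributions, each with identity covariance. Let V_1, …, V_7 be the values val(S_j-SDP) of the k = 2 semidefinite relaxation on subsets S_1, …, S_7, each drawn independently and uniformly at random from the s-element subsets of {1,…,N}. Then with probability at least 1 − c/m, both (i) val(T-IP) ≤ 3B for the full data set T = {1,…,N}, and (ii) min_{j∈[7]} V_j ≥ 2B, so that the test statistic T' = min_j V_j rejects the hypothesis E[V_1] ≤ B with p-value (B/T')^7 ≤ 2^{−7} < 0.01, certifying val(T-IP) > B with 99% confidence. -/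

import Mathlib

open MeasureTheory ProbabilityTheory
open scoped BigOperators ENNReal

/-- Finsets carry the discrete σ-algebra. -/
instance finsetMeasurableSpace {α : Type*} : MeasurableSpace (Finset α) := ⊤

/-- The optimal `k`-means value of a finite collection of points
`x : T → ℝ^m` (empty clusters contribute zero). -/
noncomputable def kmeansVal {m : ℕ} {T : Type*} [Fintype T] (k : ℕ)
    (x : T → EuclideanSpace ℝ (Fin m)) : ℝ :=
  ⨅ c : T → Fin k,
    (Fintype.card T : ℝ)⁻¹ *
      ∑ t : Fin k,
        ∑ i ∈ Finset.univ.filter (fun i => c i = t),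
          ‖x i - ((Finset.univ.filter (fun j => c j = t)).card : ℝ)⁻¹ •
            ∑ j ∈ Finset.univ.filter (fun j => c j = t), x j‖ ^ 2

/-- The value of the Peng–Wei semidefinite relaxation of `k`-means for the
points `x : S → ℝ^m`. -/
noncomputable def sdpVal {m : ℕ} {S : Type*} [Fintype S] (k : ℕ)
    (x : S → EuclideanSpace ℝ (Fin m)) : ℝ :=
  sInf {v : ℝ | ∃ X : Matrix S S ℝ,
    X.PosSemidef ∧ (∀ i j, 0 ≤ X i j) ∧
    X.mulVec (fun _ => (1 : ℝ)) = (fun _ => (1 : ℝ)) ∧ X.trace = (k : ℝ) ∧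
    v = (2 * (Fintype.card S : ℝ))⁻¹ *
      ((Matrix.of fun i j => ‖x i - x j‖ ^ 2) * X).trace}

/-- The standard Gaussian measure on `ℝ^m` (identity covariance, mean zero). -/
noncomputable def stdGaussianE (m : ℕ) : Measure (EuclideanSpace ℝ (Fin m)) :=
  (Measure.pi fun _ : Fin m => gaussianReal 0 1).map
    (EuclideanSpace.equiv (Fin m) ℝ).symm

/-- The Gaussian measure on `ℝ^m` with mean `c` and identity covariance. -/
noncomputable def gaussianId {m : ℕ} (c : EuclideanSpace ℝ (Fin m)) :
    Measure (EuclideanSpace ℝ (Fin m)) :=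
  (stdGaussianE m).map (fun z => c + z)

/-- A mixture of two Gaussians on `ℝ^m`, each with identity covariance:
`p · N(c₁, I) + (1 - p) · N(c₂, I)`. -/
noncomputable def gaussianMixture {m : ℕ} (p : ℝ)
    (c₁ c₂ : EuclideanSpace ℝ (Fin m)) : Measure (EuclideanSpace ℝ (Fin m)) :=
  ENNReal.ofReal p • gaussianId c₁ + ENNReal.ofReal (1 - p) • gaussianId c₂

/-- The uniform probability measure on the `s`-element subsets of `Fin N`. -/
noncomputable def uniformSubsets (N s : ℕ) : Measure (Finset (Fin N)) :=
  ((N.choose s : ℝ≥0∞))⁻¹ •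
    ∑ A ∈ Finset.powersetCard s (Finset.univ : Finset (Fin N)), Measure.dirac A

/-! ### Deterministic part -/

lemma mc_mean_le {E : Type*} [NormedAddCommGroup E] [InnerProductSpace ℝ E] {ι : Type*}
    (A : Finset ι) (x : ι → E) (c : E) :
    ∑ i ∈ A, ‖x i - (A.card : ℝ)⁻¹ • ∑ j ∈ A, x j‖ ^ 2 ≤ ∑ i ∈ A, ‖x i - c‖ ^ 2 := by
  rcases A.eq_empty_or_nonempty with rfl | hA
  · simp
  set μ := (A.card : ℝ)⁻¹ • ∑ j ∈ A, x j with hμ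
  have hc : (A.card : ℝ) ≠ 0 := by exact_mod_cast hA.card_pos.ne'
  have hsum : ∑ i ∈ A, (x i - μ) = 0 := by
    rw [Finset.sum_sub_distrib, Finset.sum_const, ← Nat.cast_smul_eq_nsmul ℝ, hμ, smul_smul,
      mul_inv_cancel₀ hc, one_smul, sub_self]
  have key : ∑ i ∈ A, ‖x i - c‖ ^ 2 =
      ∑ i ∈ A, ‖x i - μ‖ ^ 2 + (A.card : ℝ) * ‖μ - c‖ ^ 2 := by
    have h1 : ∀ i, ‖x i - c‖ ^ 2 =
        ‖x i - μ‖ ^ 2 + 2 * inner ℝ (x i - μ) (μ - c) + ‖μ - c‖ ^ 2 := by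
      intro i
      rw [← norm_add_sq_real]; congr 2; abel
    simp_rw [h1, Finset.sum_add_distrib, ← Finset.mul_sum, ← sum_inner, hsum]
    simp
  rw [key]
  have : 0 ≤ (A.card : ℝ) * ‖μ - c‖ ^ 2 := by positivity
  linarith

lemma mc_kmeans_le {m : ℕ} {T : Type*} [Fintype T] (x : T → EuclideanSpace ℝ (Fin m))
    (b : T → Bool) (c₁ c₂ : EuclideanSpace ℝ (Fin m)) :
    kmeansVal 2 x ≤ (Fintype.card T : ℝ)⁻¹ * ∑ i, ‖x i - (if b i then c₁ else c₂)‖ ^ 2 := by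
  unfold kmeansVal
  refine (ciInf_le (Set.finite_range _).bddBelow (fun i => if b i then (0 : Fin 2) else 1)).trans ?_
  refine mul_le_mul_of_nonneg_left ?_ (by positivity)
  refine (Finset.sum_le_sum fun t _ =>
    mc_mean_le _ x (if t = 0 then c₁ else c₂)).trans (le_of_eq ?_)
  rw [← Finset.sum_fiberwise Finset.univ (fun i => if b i then (0 : Fin 2) else 1)
    (fun i => ‖x i - (if b i then c₁ else c₂)‖ ^ 2)]
  refine Finset.sum_congr rfl fun t _ => Finset.sum_congr rfl fun i hi => ?_
  rw [Finset.mem_filter] at hi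
  rw [← hi.2]
  cases b i <;> simp

lemma mc_psd_sq_le {S : Type*} [Fintype S] [DecidableEq S] {X : Matrix S S ℝ}
    (hX : X.PosSemidef) (i j : S) : X i j ^ 2 ≤ X i i * X j j := by
  have hsymm : X j i = X i j := by simpa using hX.1.apply i j
  have hq : ∀ t : ℝ, 0 ≤ X i i * (t * t) + (2 * X i j) * t + X j j := by
    intro t
    have h := hX.dotProduct_mulVec_nonneg (t • Pi.single i (1 : ℝ) + Pi.single j (1 : ℝ))
    simp [Matrix.mulVec_add, Matrix.mulVec_smul, hsymm] at h
    linarith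
  have := discrim_le_zero hq
  unfold discrim at this
  nlinarith

lemma mc_psd_frob_le {S : Type*} [Fintype S] {X : Matrix S S ℝ}
    (hX : X.PosSemidef) : ∑ i, ∑ j, X i j ^ 2 ≤ X.trace ^ 2 := by
  classical
  rw [Matrix.trace, sq, Finset.sum_mul_sum]
  exact Finset.sum_le_sum fun i _ => Finset.sum_le_sum fun j _ => mc_psd_sq_le hX i j

lemma mc_cs {S : Type*} [Fintype S] (X K : S → S → ℝ) {t F : ℝ} (ht : 0 ≤ t) (hF : 0 ≤ F)
    (hX : ∑ i, ∑ j, X i j ^ 2 ≤ t ^ 2) (hK : ∑ i, ∑ j, K i j ^ 2 ≤ F ^ 2) :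
    ∑ i, ∑ j, X i j * K i j ≤ t * F := by
  have h := Finset.sum_mul_sq_le_sq_mul_sq (Finset.univ : Finset (S × S))
    (fun p => X p.1 p.2) (fun p => K p.1 p.2)
  simp only [Fintype.sum_prod_type] at h
  refine abs_le_of_sq_le_sq' (h.trans ?_) (by positivity) |>.2
  rw [mul_pow]
  exact mul_le_mul hX hK (Finset.sum_nonneg fun _ _ => Finset.sum_nonneg fun _ _ => sq_nonneg _)
    (sq_nonneg _)

lemma mc_dir_le {E : Type*} [NormedAddCommGroup E] [InnerProductSpace ℝ E] {S : Type*} [Fintype S]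
    (g : S → E) (u : E) (hu : ‖u‖ ≤ 1) {F : ℝ} (hF : 0 ≤ F)
    (hK : ∑ i, ∑ j, (inner ℝ (g i) (g j)) ^ 2 ≤ F ^ 2) :
    ∑ i, (inner ℝ u (g i)) ^ 2 ≤ F := by
  set a : S → ℝ := fun i => inner ℝ u (g i) with ha
  set q := ∑ i, a i ^ 2 with hq
  have hq0 : 0 ≤ q := Finset.sum_nonneg fun _ _ => sq_nonneg _
  have h1 : q = inner ℝ u (∑ i, a i • g i) := by
    simp [inner_sum, inner_smul_right, hq, sq, ha]
  have h2 : ‖∑ i, a i • g i‖ ^ 2 ≤ q * F := by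
    rw [← real_inner_self_eq_norm_sq]
    simp only [sum_inner, inner_sum, inner_smul_left, inner_smul_right]
    simp only [conj_trivial, Finset.mul_sum]
    refine (le_of_eq ?_).trans
      (mc_cs (fun i j => a i * a j) (fun i j => inner ℝ (g i) (g j)) hq0 hF (le_of_eq ?_) hK)
    · exact Finset.sum_congr rfl fun i _ => Finset.sum_congr rfl fun j _ => by
        rw [real_inner_comm]; ring
    · rw [hq, sq, Finset.sum_mul_sum]
      simp_rw [mul_pow]
  have h3 : q ≤ ‖∑ i, a i • g i‖ := by
    rw [h1]
    refine (real_inner_le_norm _ _).trans ?_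
    exact mul_le_of_le_one_left (norm_nonneg _) hu
  have h4 : q ^ 2 ≤ q * F := (pow_le_pow_left₀ hq0 h3 2).trans h2
  by_contra hlt
  push Not at hlt
  have : 0 < q := hF.trans_lt hlt
  nlinarith

lemma mc_proj {E : Type*} [NormedAddCommGroup E] [InnerProductSpace ℝ E] (d : E) :
    ∃ u : E, ‖u‖ ≤ 1 ∧ ∀ (w : E) (t : ℝ), ‖w‖ ^ 2 - (inner ℝ u w) ^ 2 ≤ ‖w + t • d‖ ^ 2 := by
  by_cases hd : d = 0
  · refine ⟨0, by simp, fun w t => by simp [hd]⟩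
  have hn : ‖d‖ ≠ 0 := by simpa using hd
  refine ⟨(‖d‖)⁻¹ • d, by simp [norm_smul, hn], fun w t => ?_⟩
  rw [norm_add_sq_real, inner_smul_left, inner_smul_right, norm_smul, mul_pow ‖t‖,
    real_inner_comm d w]
  simp only [conj_trivial, Real.norm_eq_abs, sq_abs]
  generalize (inner ℝ d w : ℝ) = r
  obtain ⟨y, hy⟩ : ∃ y, y = ‖d‖⁻¹ * r := ⟨_, rfl⟩
  have h1 : r = ‖d‖ * y := by rw [hy]; field_simp
  rw [← hy, h1]
  nlinarith [sq_nonneg (t * ‖d‖ + y)]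

lemma mc_sdp_quad {S : Type*} [Fintype S] {E : Type*} [NormedAddCommGroup E]
    [InnerProductSpace ℝ E] {X : Matrix S S ℝ} (hs : ∀ i j, X j i = X i j)
    (h1 : ∀ i, ∑ j, X i j = 1) (g : S → E) :
    ∑ i, ∑ j, X i j * ‖g i - g j‖ ^ 2 =
      2 * (∑ i, ‖g i‖ ^ 2 - ∑ i, ∑ j, X i j * inner ℝ (g i) (g j)) := by
  have e : ∀ i j, X i j * ‖g i - g j‖ ^ 2 = X i j * ‖g i‖ ^ 2 + X i j * ‖g j‖ ^ 2
      - 2 * (X i j * inner ℝ (g i) (g j)) := by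
    intro i j; rw [norm_sub_sq_real]; ring
  simp_rw [e, Finset.sum_sub_distrib, Finset.sum_add_distrib, ← Finset.mul_sum]
  have a1 : ∑ i, ∑ j, X i j * ‖g i‖ ^ 2 = ∑ i, ‖g i‖ ^ 2 := by
    simp_rw [← Finset.sum_mul, h1, one_mul]
  have a2 : ∑ i, ∑ j, X i j * ‖g j‖ ^ 2 = ∑ i, ‖g i‖ ^ 2 := by
    rw [Finset.sum_comm, ← a1]
    exact Finset.sum_congr rfl fun i _ => Finset.sum_congr rfl fun j _ => by rw [hs]
  rw [a1, a2]
  ring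

lemma mc_sdp_feasible {S : Type*} [Fintype S] (hS : 2 ≤ Fintype.card S) :
    ∃ X : Matrix S S ℝ, X.PosSemidef ∧ (∀ i j, 0 ≤ X i j) ∧
      X.mulVec (fun _ => (1 : ℝ)) = (fun _ => (1 : ℝ)) ∧ X.trace = ((2 : ℕ) : ℝ) := by
  classical
  set n : ℝ := (Fintype.card S : ℝ) with hn
  have hn2 : 2 ≤ n := by rw [hn]; exact_mod_cast hS
  set l : ℝ := 1 / (n - 1) with hl
  have hl0 : 0 ≤ l := by rw [hl]; apply div_nonneg <;> linarith
  have hl1 : l ≤ 1 := by rw [hl, div_le_one] <;> linarith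
  have hr0 : 0 ≤ (1 - l) / n := div_nonneg (by linarith) (by linarith)
  refine ⟨l • (1 : Matrix S S ℝ) + ((1 - l) / n) • Matrix.vecMulVec (fun _ => 1) (fun _ => 1),
    ?_, ?_, ?_, ?_⟩
  · refine Matrix.PosSemidef.add (Matrix.PosSemidef.one.smul hl0) (Matrix.PosSemidef.smul ?_ hr0)
    simpa using Matrix.posSemidef_vecMulVec_self_star (fun _ : S => (1 : ℝ))
  · intro i j
    simp only [Matrix.add_apply, Matrix.smul_apply, Matrix.vecMulVec_apply, Matrix.one_apply,
      smul_eq_mul]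
    split_ifs <;> simp <;> linarith
  · ext i
    simp [Matrix.mulVec, dotProduct, Matrix.one_apply, Matrix.vecMulVec_apply,
      Finset.sum_add_distrib, ← hn]
    field_simp
    ring
  · simp [Matrix.trace, Matrix.vecMulVec_apply, ← hn]
    have : n - 1 ≠ 0 := by linarith
    rw [hl]
    field_simp
    ring

lemma mc_sdp_ge {m : ℕ} {S : Type*} [Fintype S] (hS : 2 ≤ Fintype.card S)
    (g : S → EuclideanSpace ℝ (Fin m)) (b : S → Bool) (c₁ c₂ : EuclideanSpace ℝ (Fin m))
    {F : ℝ} (hF : 0 ≤ F) (hK : ∑ i, ∑ j, (inner ℝ (g i) (g j)) ^ 2 ≤ F ^ 2) :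
    (Fintype.card S : ℝ)⁻¹ * (∑ i, ‖g i‖ ^ 2 - 3 * F) ≤
      sdpVal 2 (fun i => (if b i then c₁ else c₂) + g i) := by
  unfold sdpVal
  apply le_csInf
  · obtain ⟨X, h⟩ := mc_sdp_feasible hS
    exact ⟨_, X, h.1, h.2.1, h.2.2.1, h.2.2.2, rfl⟩
  rintro v ⟨X, hX, hnn, h1, htr, rfl⟩
  have hs : ∀ i j, X j i = X i j := fun i j => by simpa using hX.1.apply i j
  have h1' : ∀ i, ∑ j, X i j = 1 := by
    intro i
    have := congrFun h1 i
    simpa [Matrix.mulVec, dotProduct] using this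
  obtain ⟨u, hu, hproj⟩ := mc_proj (c₁ - c₂)
  set x : S → EuclideanSpace ℝ (Fin m) := fun i => (if b i then c₁ else c₂) + g i with hx
  have hlow : ∀ i j, ‖g i - g j‖ ^ 2 - ‖inner ℝ u (g i) - inner ℝ u (g j)‖ ^ 2
      ≤ ‖x i - x j‖ ^ 2 := by
    intro i j
    have : ∃ t : ℝ, x i - x j = (g i - g j) + t • (c₁ - c₂) := by
      simp only [hx]
      cases b i <;> cases b j
      · exact ⟨0, by simp⟩
      · exact ⟨-1, by simp; abel⟩
      · exact ⟨1, by simp; abel⟩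
      · exact ⟨0, by simp⟩
    obtain ⟨t, ht⟩ := this
    rw [ht, ← inner_sub_right, Real.norm_eq_abs, sq_abs]
    exact hproj _ t
  have htrace : ((Matrix.of fun i j => ‖x i - x j‖ ^ 2) * X).trace =
      ∑ i, ∑ j, X i j * ‖x i - x j‖ ^ 2 := by
    simp only [Matrix.trace, Matrix.diag, Matrix.mul_apply, Matrix.of_apply]
    exact Finset.sum_congr rfl fun i _ => Finset.sum_congr rfl fun j _ => by
      rw [hs i j, mul_comm]
  rw [htrace]
  have hge : ∑ i, ∑ j, X i j * ‖g i - g j‖ ^ 2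
      - ∑ i, ∑ j, X i j * ‖inner ℝ u (g i) - inner ℝ u (g j)‖ ^ 2
      ≤ ∑ i, ∑ j, X i j * ‖x i - x j‖ ^ 2 := by
    simp only [← Finset.sum_sub_distrib, ← mul_sub]
    exact Finset.sum_le_sum fun i _ => Finset.sum_le_sum fun j _ =>
      mul_le_mul_of_nonneg_left (hlow i j) (hnn i j)
  rw [mc_sdp_quad hs h1' g, mc_sdp_quad hs h1' (fun i => inner ℝ u (g i))] at hge
  have hA : ∑ i, ∑ j, X i j * inner ℝ (g i) (g j) ≤ 2 * F := by
    refine mc_cs _ _ (by norm_num) hF ?_ hK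
    have := mc_psd_frob_le hX
    rw [htr] at this
    simpa using this
  have hB : ∑ i, ‖(inner ℝ u (g i) : ℝ)‖ ^ 2 ≤ F := by
    simpa using mc_dir_le g u hu hF hK
  have hC : 0 ≤ ∑ i, ∑ j, X i j * inner ℝ (inner ℝ u (g i)) (inner ℝ u (g j)) := by
    have := hX.dotProduct_mulVec_nonneg (fun i => inner ℝ u (g i))
    refine this.trans (le_of_eq ?_)
    simp only [dotProduct, Matrix.mulVec, Finset.mul_sum]
    exact Finset.sum_congr rfl fun i _ => Finset.sum_congr rfl fun j _ => by
      simp; ring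
  have : (Fintype.card S : ℝ)⁻¹ * (∑ i, ‖g i‖ ^ 2 - 3 * F) =
      (2 * (Fintype.card S : ℝ))⁻¹ * (2 * (∑ i, ‖g i‖ ^ 2 - 3 * F)) := by
    rw [mul_inv]; ring
  rw [this]
  refine mul_le_mul_of_nonneg_left ?_ (by positivity)
  linarith

/-! ### Gaussian estimates -/

lemma mc_mgf_real {a : ℝ} (ha : a < 1 / 2) :
    ∫⁻ x, ENNReal.ofReal (Real.exp (a * x ^ 2)) ∂(gaussianReal 0 1) =
      ENNReal.ofReal (√(1 - 2 * a))⁻¹ := by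
  rw [gaussianReal_of_var_ne_zero _ one_ne_zero,
    lintegral_withDensity_eq_lintegral_mul _ (measurable_gaussianPDF _ _) (by fun_prop)]
  have h : ∀ x : ℝ, (gaussianPDF 0 1 * fun x => ENNReal.ofReal (Real.exp (a * x ^ 2))) x =
      ENNReal.ofReal ((√(2 * Real.pi))⁻¹ * Real.exp (-(1 / 2 - a) * x ^ 2)) := by
    intro x
    rw [Pi.mul_apply, gaussianPDF, ← ENNReal.ofReal_mul (gaussianPDFReal_nonneg _ _ _),
      gaussianPDFReal]
    congr 1
    simp only [NNReal.coe_one, mul_one, sub_zero]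
    rw [mul_assoc, ← Real.exp_add]
    congr 2
    ring
  simp_rw [h]
  have hpos : 0 < 1 / 2 - a := by linarith
  rw [← ofReal_integral_eq_lintegral_ofReal ((integrable_exp_neg_mul_sq hpos).const_mul _)
    (ae_of_all _ fun x => by positivity), integral_const_mul, integral_gaussian]
  congr 1
  rw [← Real.sqrt_inv, ← Real.sqrt_mul (by positivity), ← Real.sqrt_inv]
  congr 1
  have : 1 - 2 * a ≠ 0 := by linarith
  have h2 : 1 / 2 - a ≠ 0 := hpos.ne'
  field_simp

lemma mc_stdGaussianE_eq (m : ℕ) :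
    stdGaussianE m = stdGaussian (EuclideanSpace ℝ (Fin m)) := by
  rw [← map_pi_eq_stdGaussian]; rfl

instance mc_isProb_std (m : ℕ) : IsProbabilityMeasure (stdGaussianE m) := by
  rw [mc_stdGaussianE_eq]; infer_instance

lemma mc_mgf_vec (m : ℕ) {a : ℝ} (ha : a < 1 / 2) :
    ∫⁻ g, ENNReal.ofReal (Real.exp (a * ‖g‖ ^ 2)) ∂(stdGaussianE m) =
      ENNReal.ofReal (√(1 - 2 * a))⁻¹ ^ m := by
  rw [mc_stdGaussianE_eq, ← map_pi_eq_stdGaussian, lintegral_map (by fun_prop) (by fun_prop)]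
  have h : ∀ x : Fin m → ℝ, ENNReal.ofReal (Real.exp (a * ‖WithLp.toLp 2 x‖ ^ 2)) =
      ∏ i, ENNReal.ofReal (Real.exp (a * (x i) ^ 2)) := by
    intro x
    rw [EuclideanSpace.norm_sq_eq, Finset.mul_sum, Real.exp_sum,
      ENNReal.ofReal_prod_of_nonneg (fun i _ => (Real.exp_pos _).le)]
    simp
  simp_rw [h]
  rw [lintegral_prod_eq_prod_lintegral_of_indepFun Finset.univ
    (fun i (x : Fin m → ℝ) => ENNReal.ofReal (Real.exp (a * (x i) ^ 2)))
    (iIndepFun_pi (X := fun _ y => ENNReal.ofReal (Real.exp (a * y ^ 2)))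
      (fun i => by fun_prop)) (fun i => by fun_prop)]
  have h2 : ∀ i : Fin m, ∫⁻ x, ENNReal.ofReal (Real.exp (a * (x i) ^ 2))
      ∂(Measure.pi fun _ : Fin m => gaussianReal 0 1) = ENNReal.ofReal (√(1 - 2 * a))⁻¹ := by
    intro i
    rw [(measurePreserving_eval (fun _ : Fin m => gaussianReal 0 1) i).lintegral_comp
      (f := fun y => ENNReal.ofReal (Real.exp (a * y ^ 2))) (by fun_prop), mc_mgf_real ha]
  simp [h2]

lemma mc_mgf_pi (m N : ℕ) (A : Finset (Fin N)) {a : ℝ} (ha : a < 1 / 2) :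
    ∫⁻ g, ENNReal.ofReal (Real.exp (a * ∑ i ∈ A, ‖g i‖ ^ 2))
      ∂(Measure.pi fun _ : Fin N => stdGaussianE m) =
      ENNReal.ofReal ((√(1 - 2 * a))⁻¹ ^ (m * A.card)) := by
  have h : ∀ g : Fin N → EuclideanSpace ℝ (Fin m),
      ENNReal.ofReal (Real.exp (a * ∑ i ∈ A, ‖g i‖ ^ 2)) =
      ∏ i ∈ A, ENNReal.ofReal (Real.exp (a * ‖g i‖ ^ 2)) := by
    intro g
    rw [Finset.mul_sum, Real.exp_sum,
      ENNReal.ofReal_prod_of_nonneg (fun i _ => (Real.exp_pos _).le)]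
  simp_rw [h]
  rw [lintegral_prod_eq_prod_lintegral_of_indepFun A
    (fun i (g : Fin N → EuclideanSpace ℝ (Fin m)) => ENNReal.ofReal (Real.exp (a * ‖g i‖ ^ 2)))
    (iIndepFun_pi (X := fun _ y => ENNReal.ofReal (Real.exp (a * ‖y‖ ^ 2)))
      (fun i => by fun_prop)) (fun i => by fun_prop)]
  have h2 : ∀ i : Fin N, ∫⁻ g, ENNReal.ofReal (Real.exp (a * ‖g i‖ ^ 2))
      ∂(Measure.pi fun _ : Fin N => stdGaussianE m) = ENNReal.ofReal (√(1 - 2 * a))⁻¹ ^ m := by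
    intro i
    rw [(measurePreserving_eval (fun _ : Fin N => stdGaussianE m) i).lintegral_comp
      (f := fun y => ENNReal.ofReal (Real.exp (a * ‖y‖ ^ 2))) (by fun_prop), mc_mgf_vec m ha]
  simp only [h2, Finset.prod_const]
  rw [← pow_mul, ENNReal.ofReal_pow (by positivity)]

/-- Chernoff bound, for both tails. -/
lemma mc_chernoff (m N : ℕ) (A : Finset (Fin N)) {a θ : ℝ} (ha : a < 1 / 2) :
    (Measure.pi fun _ : Fin N => stdGaussianE m)
      {g | a * θ ≤ a * ∑ i ∈ A, ‖g i‖ ^ 2} ≤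
      ENNReal.ofReal (Real.exp (-(a * θ)) * (√(1 - 2 * a))⁻¹ ^ (m * A.card)) := by
  rw [ENNReal.ofReal_mul (Real.exp_pos _).le, ← mc_mgf_pi m N A ha,
    ← lintegral_const_mul _ (by fun_prop)]
  have hmeas : Measurable fun g : Fin N → EuclideanSpace ℝ (Fin m) =>
      ENNReal.ofReal (Real.exp (-(a * θ))) *
        ENNReal.ofReal (Real.exp (a * ∑ i ∈ A, ‖g i‖ ^ 2)) := by
    fun_prop
  refine meas_le_lintegral₀ hmeas.aemeasurable fun g hg => ?_
  rw [← ENNReal.ofReal_mul (Real.exp_pos _).le, ← Real.exp_add, ENNReal.one_le_ofReal,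
    Real.one_le_exp_iff]
  simp only [Set.mem_ofPred_eq] at hg
  linarith

lemma mc_sqrt_bound {u : ℝ} (h0 : 0 ≤ u) (h1 : u ≤ 1 / 3) :
    (√(1 - u))⁻¹ ≤ Real.exp ((u + u ^ 2) / 2) := by
  have hk : 1 ≤ Real.exp (u + u ^ 2) * (1 - u) := by
    have := Real.quadratic_le_exp_of_nonneg (x := u + u ^ 2) (by positivity)
    have h3 : 0 ≤ 1 - u := by linarith
    have := mul_le_mul_of_nonneg_right this h3
    refine le_trans ?_ this
    have : 0 ≤ u ^ 2 := sq_nonneg u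
    have : 0 ≤ u ^ 3 := pow_nonneg h0 3
    have : 0 ≤ u ^ 4 := pow_nonneg h0 4
    nlinarith [mul_nonneg (sq_nonneg u) (sub_nonneg.2 h1),
      mul_nonneg (pow_nonneg h0 3) (sub_nonneg.2 h1), mul_nonneg (pow_nonneg h0 4) (sub_nonneg.2 h1)]
  have hu : 0 < 1 - u := by linarith
  have hs : 0 < √(1 - u) := Real.sqrt_pos.2 hu
  rw [inv_le_iff_one_le_mul₀ hs]
  have : Real.exp ((u + u ^ 2) / 2) = √(Real.exp (u + u ^ 2)) := by
    rw [Real.exp_half]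
  rw [this, ← Real.sqrt_mul (Real.exp_pos _).le, Real.one_le_sqrt]
  exact hk

/-- Upper tail. -/
lemma mc_upper (m N : ℕ) (hm : 6 ≤ m) (hN : (m : ℝ) * Real.log m ≤ N) :
    (Measure.pi fun _ : Fin N => stdGaussianE m)
      {g | (m + 3 : ℝ) * N ≤ ∑ i, ‖g i‖ ^ 2} ≤ ENNReal.ofReal (1 / m) := by
  have hm6 : (6 : ℝ) ≤ m := by exact_mod_cast hm
  have hm0 : (0 : ℝ) < m := by linarith
  have ha : (1 / m : ℝ) < 1 / 2 := by
    rw [div_lt_div_iff₀ hm0 (by norm_num)]; linarith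
  refine le_trans (measure_mono fun g hg => ?_)
    ((mc_chernoff m N Finset.univ (a := 1 / m) (θ := (m + 3 : ℝ) * N) ha).trans ?_)
  · simp only [Set.mem_ofPred_eq] at hg ⊢
    exact mul_le_mul_of_nonneg_left hg (by positivity)
  apply ENNReal.ofReal_le_ofReal
  have hu : 2 * (1 / m : ℝ) ≤ 1 / 3 := by
    rw [mul_one_div, div_le_div_iff₀ hm0 (by norm_num)]; linarith
  have h1 := mc_sqrt_bound (u := 2 * (1 / m : ℝ)) (by positivity) hu
  have h2 : (√(1 - 2 * (1 / m : ℝ)))⁻¹ ^ (m * (Finset.univ : Finset (Fin N)).card) ≤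
      Real.exp (N + 2 * N / m) := by
    refine (pow_le_pow_left₀ (by positivity) h1 _).trans (le_of_eq ?_)
    rw [← Real.exp_nat_mul]
    congr 1
    simp only [Finset.card_univ, Fintype.card_fin, Nat.cast_mul]
    field_simp
  refine (mul_le_mul_of_nonneg_left h2 (Real.exp_pos _).le).trans ?_
  rw [← Real.exp_add]
  have h3 : -(1 / m * ((m + 3 : ℝ) * N)) + (N + 2 * N / m) = -(N / m : ℝ) := by
    field_simp; ring
  rw [h3, one_div, ← Real.exp_log (inv_pos.2 hm0), Real.exp_le_exp, Real.log_inv, neg_le_neg_iff,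
    le_div_iff₀ hm0]
  linarith

/-- Lower tail. -/
lemma mc_lower (m N : ℕ) (A : Finset (Fin N)) (hm : 1 ≤ m) (hA : 1 ≤ A.card) :
    (Measure.pi fun _ : Fin N => stdGaussianE m)
      {g | ∑ i ∈ A, ‖g i‖ ^ 2 ≤ 4 / 5 * ((m : ℝ) * A.card)} ≤ ENNReal.ofReal (200 / m) := by
  have hm0 : (1 : ℝ) ≤ m := by exact_mod_cast hm
  have hA0 : (1 : ℝ) ≤ A.card := by exact_mod_cast hA
  refine le_trans (measure_mono fun g hg => ?_)
    ((mc_chernoff m N A (a := -1 / 8) (θ := 4 / 5 * ((m : ℝ) * A.card)) (by norm_num)).trans ?_)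
  · simp only [Set.mem_ofPred_eq] at hg ⊢
    linarith
  apply ENNReal.ofReal_le_ofReal
  have h1 : (√(1 - 2 * (-1 / 8 : ℝ)))⁻¹ ≤ Real.exp (-(21 / 200)) := by
    rw [Real.exp_neg]
    apply inv_anti₀ (Real.exp_pos _)
    apply Real.le_sqrt_of_sq_le
    rw [← Real.exp_nat_mul]
    have : Real.exp (-(21 / 400)) ≥ 1 - 21 / 400 := by
      have := Real.add_one_le_exp (-(21 / 400) : ℝ)
      linarith
    have h4 : Real.exp (((2 : ℕ) : ℝ) * (21 / 200)) = (Real.exp (-(21 / 400)))⁻¹ ^ 4 := by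
      rw [← Real.exp_neg, ← Real.exp_nat_mul]; congr 1; norm_num
    rw [h4]
    have h5 : (Real.exp (-(21 / 400)))⁻¹ ≤ (1 - 21 / 400 : ℝ)⁻¹ := inv_anti₀ (by norm_num) this
    refine (pow_le_pow_left₀ (by positivity) h5 4).trans (by norm_num)
  refine (mul_le_mul_of_nonneg_left (pow_le_pow_left₀ (by positivity) h1 _)
    (Real.exp_pos _).le).trans ?_
  rw [← Real.exp_nat_mul, ← Real.exp_add]
  have h6 : -(-1 / 8 * (4 / 5 * ((m : ℝ) * A.card))) + ((m * A.card : ℕ) : ℝ) * -(21 / 200) =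
      -((m : ℝ) * A.card / 200) := by push_cast; ring
  rw [h6, Real.exp_neg]
  have h7 : (m : ℝ) / 200 ≤ Real.exp ((m : ℝ) * A.card / 200) := by
    have := Real.add_one_le_exp ((m : ℝ) * A.card / 200)
    nlinarith
  calc (Real.exp ((m : ℝ) * A.card / 200))⁻¹ ≤ ((m : ℝ) / 200)⁻¹ := inv_anti₀ (by positivity) h7
    _ = 200 / m := by rw [inv_div]

lemma mc_second_moment (m : ℕ) (v : EuclideanSpace ℝ (Fin m)) :
    ∫⁻ g, ENNReal.ofReal ((inner ℝ v g) ^ 2) ∂(stdGaussianE m) = ENNReal.ofReal (‖v‖ ^ 2) := by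
  rw [mc_stdGaussianE_eq]
  have hmem : MemLp (innerSL ℝ v) 2 (stdGaussian (EuclideanSpace ℝ (Fin m))) :=
    IsGaussian.memLp_dual _ _ _ (by norm_num)
  have hvar := variance_dual_stdGaussian (innerSL ℝ v : StrongDual ℝ (EuclideanSpace ℝ (Fin m)))
  rw [variance_of_integral_eq_zero hmem.aemeasurable (integral_strongDual_stdGaussian _)] at hvar
  rw [innerSL_apply_norm] at hvar
  rw [← hvar, ofReal_integral_eq_lintegral_ofReal hmem.integrable_sq
    (ae_of_all _ fun x => sq_nonneg _)]
  rfl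

lemma mc_exp_moment (m : ℕ) (hm : 6 ≤ m) :
    ∫⁻ g, ENNReal.ofReal (Real.exp (1 / m * ‖g‖ ^ 2)) ∂(stdGaussianE m) ≤ ENNReal.ofReal 8 := by
  have hm6 : (6 : ℝ) ≤ m := by exact_mod_cast hm
  have hm0 : (0 : ℝ) < m := by linarith
  have ha : (1 / m : ℝ) < 1 / 2 := by
    rw [div_lt_div_iff₀ hm0 (by norm_num)]; linarith
  rw [mc_mgf_vec m ha, ← ENNReal.ofReal_pow (by positivity)]
  apply ENNReal.ofReal_le_ofReal
  have hu : 2 * (1 / m : ℝ) ≤ 1 / 3 := by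
    rw [mul_one_div, div_le_div_iff₀ hm0 (by norm_num)]; linarith
  have h1 := mc_sqrt_bound (u := 2 * (1 / m : ℝ)) (by positivity) hu
  refine (pow_le_pow_left₀ (by positivity) h1 _).trans ?_
  rw [← Real.exp_nat_mul]
  have h2 : (m : ℝ) * ((2 * (1 / m : ℝ) + (2 * (1 / m : ℝ)) ^ 2) / 2) ≤ 2 := by
    have : (m : ℝ) * ((2 * (1 / m : ℝ) + (2 * (1 / m : ℝ)) ^ 2) / 2) = 1 + 2 * (1 / m : ℝ) := by
      field_simp
    linarith
  refine (Real.exp_le_exp.2 h2).trans ?_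
  have h3 : Real.exp 2 = Real.exp 1 ^ 2 := by rw [← Real.exp_nat_mul]; norm_num
  rw [h3]
  have := Real.exp_one_lt_d9
  have h0 := Real.exp_pos 1
  nlinarith

lemma mc_moment2 (m : ℕ) (hm : 6 ≤ m) :
    ∫⁻ g, ENNReal.ofReal (‖g‖ ^ 2) ∂(stdGaussianE m) ≤ ENNReal.ofReal (8 * m) := by
  have hm0 : (0 : ℝ) < m := by exact_mod_cast (by omega : 0 < m)
  calc _ ≤ ∫⁻ g, ENNReal.ofReal m * ENNReal.ofReal (Real.exp (1 / m * ‖g‖ ^ 2))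
        ∂(stdGaussianE m) := by
        refine lintegral_mono fun g => ?_
        rw [← ENNReal.ofReal_mul hm0.le]
        apply ENNReal.ofReal_le_ofReal
        have := Real.add_one_le_exp (1 / m * ‖g‖ ^ 2)
        calc ‖g‖ ^ 2 = m * (1 / m * ‖g‖ ^ 2) := by field_simp
          _ ≤ _ := mul_le_mul_of_nonneg_left (by linarith) hm0.le
    _ ≤ ENNReal.ofReal m * ENNReal.ofReal 8 := by
        rw [lintegral_const_mul _ (by fun_prop)]
        gcongr
        exact mc_exp_moment m hm
    _ = _ := by rw [← ENNReal.ofReal_mul hm0.le, mul_comm]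

lemma mc_moment4 (m : ℕ) (hm : 6 ≤ m) :
    ∫⁻ g, ENNReal.ofReal ((‖g‖ ^ 2) ^ 2) ∂(stdGaussianE m) ≤ ENNReal.ofReal (16 * m ^ 2) := by
  have hm0 : (0 : ℝ) < m := by exact_mod_cast (by omega : 0 < m)
  calc _ ≤ ∫⁻ g, ENNReal.ofReal (2 * m ^ 2) * ENNReal.ofReal (Real.exp (1 / m * ‖g‖ ^ 2))
        ∂(stdGaussianE m) := by
        refine lintegral_mono fun g => ?_
        rw [← ENNReal.ofReal_mul (by positivity)]
        apply ENNReal.ofReal_le_ofReal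
        have h0 : 0 ≤ 1 / (m : ℝ) * ‖g‖ ^ 2 := by positivity
        have := Real.quadratic_le_exp_of_nonneg h0
        calc (‖g‖ ^ 2) ^ 2 = (2 * m ^ 2) * ((1 / m * ‖g‖ ^ 2) ^ 2 / 2) := by field_simp
          _ ≤ _ := mul_le_mul_of_nonneg_left (by linarith) (by positivity)
    _ ≤ ENNReal.ofReal (2 * m ^ 2) * ENNReal.ofReal 8 := by
        rw [lintegral_const_mul _ (by fun_prop)]
        gcongr
        exact mc_exp_moment m hm
    _ = _ := by rw [← ENNReal.ofReal_mul (by positivity)]; congr 1; ring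

lemma mc_cross (m N : ℕ) (hm : 6 ≤ m) (i j : Fin N) :
    ∫⁻ g, ENNReal.ofReal ((inner ℝ (g i) (g j)) ^ 2)
      ∂(Measure.pi fun _ : Fin N => stdGaussianE m) ≤
      ENNReal.ofReal ((if i = j then 16 * (m : ℝ) ^ 2 else 0) + 8 * m) := by
  by_cases hij : i = j
  · subst hij
    simp only [real_inner_self_eq_norm_sq, if_true]
    rw [(measurePreserving_eval (fun _ : Fin N => stdGaussianE m) i).lintegral_comp
      (f := fun y => ENNReal.ofReal ((‖y‖ ^ 2) ^ 2)) (by fun_prop)]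
    refine (mc_moment4 m hm).trans (ENNReal.ofReal_le_ofReal ?_)
    have : (0 : ℝ) ≤ 8 * m := by positivity
    linarith
  · simp only [hij, if_false, zero_add]
    have hind : IndepFun (fun g : Fin N → EuclideanSpace ℝ (Fin m) => g i) (fun g => g j)
        (Measure.pi fun _ : Fin N => stdGaussianE m) :=
      (iIndepFun_pi (μ := fun _ : Fin N => stdGaussianE m) (X := fun _ y => y)
        (fun i => aemeasurable_id)).indepFun hij
    have hmap := hind.map_prod_eq_prod_map_map (measurable_pi_apply i).aemeasurable
      (measurable_pi_apply j).aemeasurable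
    have he : ∀ k : Fin N, (Measure.pi fun _ : Fin N => stdGaussianE m).map (fun g => g k) =
      stdGaussianE m := fun k => (measurePreserving_eval (fun _ : Fin N => stdGaussianE m) k).map_eq
    rw [he, he] at hmap
    have hmeas : Measurable fun p : EuclideanSpace ℝ (Fin m) × EuclideanSpace ℝ (Fin m) =>
        ENNReal.ofReal ((inner ℝ p.1 p.2) ^ 2) := by
      fun_prop
    have := lintegral_map (μ := Measure.pi fun _ : Fin N => stdGaussianE m) hmeas
      (g := fun g => (g i, g j)) (by fun_prop)
    rw [hmap, lintegral_prod _ hmeas.aemeasurable] at this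
    rw [← this]
    simp only [mc_second_moment]
    exact mc_moment2 m hm

lemma mc_frob (m N : ℕ) (hm : 6 ≤ m) (A : Finset (Fin N)) (hA : m ≤ A.card) :
    (Measure.pi fun _ : Fin N => stdGaussianE m)
      {g | ((m : ℝ) * A.card / 30) ^ 2 ≤ ∑ i ∈ A, ∑ j ∈ A, (inner ℝ (g i) (g j)) ^ 2} ≤
      ENNReal.ofReal (21600 / m) := by
  have hm0 : (0 : ℝ) < m := by exact_mod_cast (by omega : 0 < m)
  have hmA : (m : ℝ) ≤ A.card := by exact_mod_cast hA
  have hA0 : (0 : ℝ) < A.card := hm0.trans_le hmA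
  set R : ℝ := ((m : ℝ) * A.card / 30) ^ 2 with hR
  have hR0 : 0 < R := by positivity
  have hE : ∫⁻ g, ENNReal.ofReal (∑ i ∈ A, ∑ j ∈ A, (inner ℝ (g i) (g j)) ^ 2)
      ∂(Measure.pi fun _ : Fin N => stdGaussianE m) ≤
      ENNReal.ofReal (A.card * (16 * (m : ℝ) ^ 2) + A.card * (A.card * (8 * m))) := by
    have h1 : ∀ g : Fin N → EuclideanSpace ℝ (Fin m),
        ENNReal.ofReal (∑ i ∈ A, ∑ j ∈ A, (inner ℝ (g i) (g j)) ^ 2) =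
        ∑ i ∈ A, ∑ j ∈ A, ENNReal.ofReal ((inner ℝ (g i) (g j)) ^ 2) := by
      intro g
      rw [ENNReal.ofReal_sum_of_nonneg fun i _ => Finset.sum_nonneg fun j _ => sq_nonneg _]
      exact Finset.sum_congr rfl fun i _ =>
        ENNReal.ofReal_sum_of_nonneg fun j _ => sq_nonneg _
    simp_rw [h1]
    rw [lintegral_finsetSum _ (fun i _ => by fun_prop)]
    have h2 : ∀ i ∈ A, ∫⁻ g, ∑ j ∈ A, ENNReal.ofReal ((inner ℝ (g i) (g j)) ^ 2)
        ∂(Measure.pi fun _ : Fin N => stdGaussianE m) ≤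
        ENNReal.ofReal (16 * (m : ℝ) ^ 2 + A.card * (8 * m)) := by
      intro i hi
      rw [lintegral_finsetSum _ (fun i _ => by fun_prop)]
      refine (Finset.sum_le_sum fun j _ => mc_cross m N hm i j).trans (le_of_eq ?_)
      rw [← ENNReal.ofReal_sum_of_nonneg (fun j _ => by split_ifs <;> positivity)]
      simp [Finset.sum_add_distrib, hi]
    refine (Finset.sum_le_sum h2).trans (le_of_eq ?_)
    rw [← ENNReal.ofReal_sum_of_nonneg (fun j _ => by positivity)]
    simp only [Finset.sum_const, nsmul_eq_mul]
    congr 1; ring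
  have hmeas : Measurable fun g : Fin N → EuclideanSpace ℝ (Fin m) =>
      ENNReal.ofReal R⁻¹ * ENNReal.ofReal (∑ i ∈ A, ∑ j ∈ A, (inner ℝ (g i) (g j)) ^ 2) := by
    fun_prop
  refine (meas_le_lintegral₀ hmeas.aemeasurable fun g hg => ?_).trans ?_
  · simp only [Set.mem_ofPred_eq] at hg
    rw [← ENNReal.ofReal_mul (by positivity), ENNReal.one_le_ofReal, ← inv_mul_cancel₀ hR0.ne']
    exact mul_le_mul_of_nonneg_left hg (by positivity)
  · rw [lintegral_const_mul _ (by fun_prop)]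
    refine (mul_le_mul_right hE _).trans ?_
    rw [← ENNReal.ofReal_mul (by positivity)]
    apply ENNReal.ofReal_le_ofReal
    rw [hR, inv_mul_le_iff₀ (by positivity)]
    have : ((m : ℝ) * A.card / 30) ^ 2 * (21600 / m) = 24 * m * A.card ^ 2 := by
      field_simp; ring
    rw [this]
    have : (A.card : ℝ) * m * m ≤ A.card * m * A.card := mul_le_mul_of_nonneg_left hmA (by positivity)
    nlinarith

/-! ### Subsampling and coupling -/

lemma mc_unif_singleton {N s : ℕ} {A : Finset (Fin N)}
    (hA : A ∈ Finset.powersetCard s (Finset.univ : Finset (Fin N))) :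
    uniformSubsets N s {A} = ((N.choose s : ℝ≥0∞))⁻¹ := by
  classical
  simp only [uniformSubsets, Measure.smul_apply, Measure.finsetSum_apply, smul_eq_mul]
  rw [Finset.sum_eq_single A]
  · simp
  · intro B _ hB
    rw [Measure.dirac_apply' _ (MeasurableSpace.measurableSet_top)]
    simp [hB]
  · exact fun h => absurd hA h

lemma mc_unif_off {N s : ℕ} :
    uniformSubsets N s {A | A ∉ Finset.powersetCard s (Finset.univ : Finset (Fin N))} = 0 := by
  simp only [uniformSubsets, Measure.smul_apply, Measure.finsetSum_apply, smul_eq_mul]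
  rw [Finset.sum_eq_zero, mul_zero]
  intro B hB
  rw [Measure.dirac_apply' _ (MeasurableSpace.measurableSet_top)]
  simp only [Set.indicator_apply_eq_zero]
  intro h
  exact absurd hB h

lemma mc_unif_prob {N s : ℕ} (h : s ≤ N) : IsProbabilityMeasure (uniformSubsets N s) := by
  constructor
  simp only [uniformSubsets, Measure.smul_apply, Measure.finsetSum_apply, smul_eq_mul, measure_univ,
    Finset.sum_const, Finset.card_powersetCard, Finset.card_univ, Fintype.card_fin, nsmul_eq_mul,
    mul_one]
  exact ENNReal.inv_mul_cancel (by exact_mod_cast (Nat.choose_pos h).ne') (ENNReal.natCast_ne_top _)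

lemma mc_subsample {Ω : Type*} [MeasurableSpace Ω] (μ : Measure Ω) [IsProbabilityMeasure μ]
    {N s : ℕ} (h : s ≤ N) (Bad : Finset (Fin N) → Set Ω) {δ : ℝ≥0∞}
    (hB : ∀ A, A.card = s → μ (Bad A) ≤ δ) (j : Fin 7) :
    (μ.prod (Measure.pi fun _ : Fin 7 => uniformSubsets N s))
      {ω | (ω.2 j).card ≠ s ∨ ω.1 ∈ Bad (ω.2 j)} ≤ δ := by
  have := mc_unif_prob h
  set ν := Measure.pi fun _ : Fin 7 => uniformSubsets N s with hν
  have hev : ∀ C : Set (Finset (Fin N)), ν {S | S j ∈ C} = uniformSubsets N s C := fun C =>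
    (measurePreserving_eval (fun _ : Fin 7 => uniformSubsets N s) j).measure_preimage
      (MeasurableSpace.measurableSet_top).nullMeasurableSet
  have hsub : {ω : Ω × (Fin 7 → Finset (Fin N)) | (ω.2 j).card ≠ s ∨ ω.1 ∈ Bad (ω.2 j)} ⊆
      (Set.univ ×ˢ {S | S j ∈ {A | A ∉ Finset.powersetCard s (Finset.univ : Finset (Fin N))}}) ∪
      ⋃ A ∈ Finset.powersetCard s (Finset.univ : Finset (Fin N)),
        (Bad A ×ˢ {S | S j ∈ ({A} : Set (Finset (Fin N)))}) := by
    rintro ⟨w, S⟩ hw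
    by_cases hc : (S j).card = s
    · right
      simp only [Set.mem_iUnion]
      refine ⟨S j, by simp [hc], ?_, rfl⟩
      rcases hw with hw | hw
      · exact absurd hc hw
      · exact hw
    · left
      exact ⟨trivial, by simpa using hc⟩
  refine (measure_mono hsub).trans ((measure_union_le _ _).trans ?_)
  rw [Measure.prod_prod, hev, mc_unif_off, mul_zero, zero_add]
  refine (measure_biUnion_finset_le _ _).trans ?_
  have : ∀ A ∈ Finset.powersetCard s (Finset.univ : Finset (Fin N)),
      (μ.prod ν) (Bad A ×ˢ {S | S j ∈ ({A} : Set (Finset (Fin N)))}) ≤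
        δ * ((N.choose s : ℝ≥0∞))⁻¹ := by
    intro A hA
    rw [Measure.prod_prod, hev, mc_unif_singleton hA]
    gcongr
    exact hB A (Finset.mem_powersetCard.1 hA).2
  refine (Finset.sum_le_sum this).trans (le_of_eq ?_)
  rw [Finset.sum_const, Finset.card_powersetCard, Finset.card_univ, Fintype.card_fin,
    nsmul_eq_mul, mul_left_comm,
    ENNReal.mul_inv_cancel (by exact_mod_cast (Nat.choose_pos h).ne') (ENNReal.natCast_ne_top _),
    mul_one]

/-- The label distribution. -/
noncomputable def mcLabel (p : ℝ) : Measure Bool :=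
  ENNReal.ofReal p • Measure.dirac true + ENNReal.ofReal (1 - p) • Measure.dirac false

lemma mc_label_prob {p : ℝ} (h0 : 0 ≤ p) (h1 : p ≤ 1) : IsProbabilityMeasure (mcLabel p) := by
  constructor
  simp only [mcLabel, Measure.add_apply, Measure.smul_apply, measure_univ, smul_eq_mul, mul_one]
  rw [← ENNReal.ofReal_add h0 (by linarith)]
  simp

/-- A labelled Gaussian sample. -/
noncomputable def mcPoint {m : ℕ} (c₁ c₂ : EuclideanSpace ℝ (Fin m))
    (w : Bool × EuclideanSpace ℝ (Fin m)) : EuclideanSpace ℝ (Fin m) :=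
  (if w.1 then c₁ else c₂) + w.2

lemma mc_point_meas {m : ℕ} (c₁ c₂ : EuclideanSpace ℝ (Fin m)) : Measurable (mcPoint c₁ c₂) := by
  unfold mcPoint
  have : Measurable fun b : Bool => if b then c₁ else c₂ := measurable_of_finite _
  exact (this.comp measurable_fst).add measurable_snd

lemma mc_mixture {m : ℕ} (p : ℝ) (c₁ c₂ : EuclideanSpace ℝ (Fin m)) :
    ((mcLabel p).prod (stdGaussianE m)).map (mcPoint c₁ c₂) = gaussianMixture p c₁ c₂ := by
  rw [mcLabel, Measure.add_prod, Measure.prod_smul_left, Measure.prod_smul_left,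
    Measure.dirac_prod, Measure.dirac_prod, Measure.map_add _ _ (mc_point_meas c₁ c₂),
    Measure.map_smul, Measure.map_smul, Measure.map_map (mc_point_meas c₁ c₂) (by fun_prop),
    Measure.map_map (mc_point_meas c₁ c₂) (by fun_prop)]
  rfl

lemma mc_deterministic {m N s : ℕ} {B : ℝ} (hm : 60 ≤ m) (hs : s = ⌈(m : ℝ) * Real.log m⌉₊)
    (hms : m ≤ s) (hN0 : 0 < N)
    (hB : B = ((m : ℝ) + 3) / 3) (c₁ c₂ : EuclideanSpace ℝ (Fin m))
    (w : Fin N → Bool × EuclideanSpace ℝ (Fin m)) (S : Fin 7 → Finset (Fin N))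
    (hU : ∑ i, ‖(w i).2‖ ^ 2 < (m + 3 : ℝ) * N)
    (hS : ∀ j, (S j).card = s)
    (hL : ∀ j, 4 / 5 * ((m : ℝ) * (S j).card) < ∑ i ∈ S j, ‖(w i).2‖ ^ 2)
    (hF : ∀ j, ∑ i ∈ S j, ∑ k ∈ S j, (inner ℝ (w i).2 (w k).2) ^ 2 <
      ((m : ℝ) * (S j).card / 30) ^ 2) :
    kmeansVal 2 (fun i => mcPoint c₁ c₂ (w i)) ≤ 3 * B ∧
      (∀ j : Fin 7, 2 * B ≤ sdpVal 2 (fun i : ↥(S j) => mcPoint c₁ c₂ (w i))) ∧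
      (B / ⨅ j : Fin 7, sdpVal 2 (fun i : ↥(S j) => mcPoint c₁ c₂ (w i))) ^ 7
        ≤ (2 : ℝ)⁻¹ ^ 7 := by
  have hm60 : (60 : ℝ) ≤ m := by exact_mod_cast hm
  have hB0 : 0 < B := by rw [hB]; positivity
  have h2 : ∀ j : Fin 7, 2 * B ≤ sdpVal 2 (fun i : ↥(S j) => mcPoint c₁ c₂ (w i)) := by
    intro j
    have hcard : Fintype.card ↥(S j) = s := by rw [Fintype.card_coe, hS]
    have hs0 : (0 : ℝ) < s := by exact_mod_cast (by omega : 0 < s)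
    refine le_trans ?_ (mc_sdp_ge (by rw [hcard]; omega) (fun i : ↥(S j) => (w i).2)
      (fun i => (w i).1) c₁ c₂ (F := (m : ℝ) * s / 30) (by positivity) ?_)
    · rw [hcard, Finset.sum_coe_sort (S j) (fun i => ‖(w i).2‖ ^ 2), hB]
      have := hL j
      rw [hS] at this
      rw [le_inv_mul_iff₀ hs0]
      nlinarith
    · have := hF j
      rw [hS] at this
      refine le_trans (le_of_eq ?_) this.le
      rw [← Finset.sum_coe_sort (S j)]
      refine Finset.sum_congr rfl fun i _ => ?_
      rw [← Finset.sum_coe_sort (S j)]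
  refine ⟨?_, h2, ?_⟩
  · refine (mc_kmeans_le _ (fun i => (w i).1) c₁ c₂).trans ?_
    have hN : (0 : ℝ) < N := by exact_mod_cast hN0
    simp only [mcPoint, add_sub_cancel_left, Fintype.card_fin]
    rw [inv_mul_le_iff₀ hN, hB]
    linarith
  · have h3 := le_ciInf h2
    have h4 : 0 < ⨅ j : Fin 7, sdpVal 2 (fun i : ↥(S j) => mcPoint c₁ c₂ (w i)) := by linarith
    refine pow_le_pow_left₀ (div_nonneg hB0.le h4.le) ?_ 7
    rw [div_le_iff₀ h4]
    linarith

/-- Monte Carlo certification for data drawn from a mixture of two Gaussians: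
there is a constant `c > 0` such that for all `m ≥ 2`, `N ≥ m log m`,
`s = ⌈m log m⌉`, `B = (m+3)/3` and `ℓ = 7`, if `x 0, …, x (N-1)` are drawn
independently from an arbitrary mixture of two Gaussians on `ℝ^m` with
identity covariance, and `S 0, …, S 6` are drawn independently and uniformly
from the `s`-element subsets of `{0, …, N-1}`, then with probability at least
`1 - c/m` one has both `val(T-IP) ≤ 3B` for the full data set (with `k = 2`)
and `min_j val(S j-SDP) ≥ 2B`, so that the test statistic rejects
`E[V] ≤ B` with `p`-value at most `(1/2)^7 < 0.01`, certifying
`val(T-IP) > B` with 99% confidence. -/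
theorem monte_carlo_certificate_gaussian_mixture :
    ∃ c : ℝ, 0 < c ∧
      ∀ (m N s : ℕ) (B : ℝ), 2 ≤ m →
        (m : ℝ) * Real.log m ≤ (N : ℝ) →
        s = ⌈(m : ℝ) * Real.log m⌉₊ →
        B = ((m : ℝ) + 3) / 3 →
        ∀ (p : ℝ), 0 ≤ p → p ≤ 1 →
        ∀ c₁ c₂ : EuclideanSpace ℝ (Fin m),
        ∀ P : Measure ((Fin N → EuclideanSpace ℝ (Fin m)) × (Fin 7 → Finset (Fin N))),
          P = (Measure.pi fun _ : Fin N => gaussianMixture p c₁ c₂).prod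
                (Measure.pi fun _ : Fin 7 => uniformSubsets N s) →
          1 - ENNReal.ofReal (c / (m : ℝ)) ≤
            P {ω | kmeansVal 2 ω.1 ≤ 3 * B ∧
                   (∀ j : Fin 7, 2 * B ≤ sdpVal 2 (fun i : ↥(ω.2 j) => ω.1 i)) ∧
                   (B / ⨅ j : Fin 7, sdpVal 2 (fun i : ↥(ω.2 j) => ω.1 i)) ^ 7
                     ≤ (2 : ℝ)⁻¹ ^ 7} := by
  classical
  refine ⟨152601, by norm_num, ?_⟩
  intro m N s B hm2 hN hs hB p hp0 hp1 c₁ c₂ P hP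
  have hm0 : (0 : ℝ) < m := by exact_mod_cast (by omega : 0 < m)
  by_cases hm : m < 60
  · have : 1 - ENNReal.ofReal (152601 / (m : ℝ)) = 0 := by
      apply tsub_eq_zero_of_le
      rw [ENNReal.one_le_ofReal, one_le_div hm0]
      have : (m : ℝ) < 60 := by exact_mod_cast hm
      linarith
    rw [this]
    exact zero_le
  push Not at hm
  have hm60 : (60 : ℝ) ≤ m := by exact_mod_cast hm
  have hsN : s ≤ N := by rw [hs]; exact Nat.ceil_le.2 hN
  have hlog : 1 ≤ Real.log m := by
    rw [Real.le_log_iff_exp_le hm0]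
    have := Real.exp_one_lt_d9
    linarith
  have hms : m ≤ s := by
    have h1 : (m : ℝ) ≤ s := by
      rw [hs]
      refine le_trans ?_ (Nat.le_ceil _)
      nlinarith
    exact_mod_cast h1
  have := mc_label_prob hp0 hp1
  have := mc_unif_prob hsN
  set ρ := (mcLabel p).prod (stdGaussianE m) with hρ
  set μ := Measure.pi fun _ : Fin N => ρ with hμ
  set ν := Measure.pi fun _ : Fin 7 => uniformSubsets N s with hν
  have hΦ : Measurable fun (w : Fin N → Bool × EuclideanSpace ℝ (Fin m)) (i : Fin N) =>
      mcPoint c₁ c₂ (w i) :=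
    measurable_pi_lambda _ fun i => (mc_point_meas c₁ c₂).comp (measurable_pi_apply i)
  have hmix : Measure.pi (fun _ : Fin N => gaussianMixture p c₁ c₂) =
      μ.map (fun w i => mcPoint c₁ c₂ (w i)) := by
    have : IsProbabilityMeasure (ρ.map (mcPoint c₁ c₂)) :=
      Measure.isProbabilityMeasure_map (mc_point_meas c₁ c₂).aemeasurable
    rw [hμ, Measure.pi_map_pi (fun i => (mc_point_meas c₁ c₂).aemeasurable)]
    simp only [hρ, mc_mixture]
  have hPmap : P = (μ.prod ν).map (Prod.map (fun w i => mcPoint c₁ c₂ (w i)) id) := by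
    rw [hP, hmix, ← Measure.map_prod_map μ ν hΦ measurable_id, Measure.map_id]
  rw [hPmap]
  refine le_trans ?_ (Measure.le_map_apply (hΦ.prodMap measurable_id).aemeasurable _)
  -- transfer of Gaussian events
  have hsnd : MeasurePreserving (fun (w : Fin N → Bool × EuclideanSpace ℝ (Fin m)) i => (w i).2)
      μ (Measure.pi fun _ : Fin N => stdGaussianE m) :=
    measurePreserving_pi _ _ fun i => measurePreserving_snd
  have hev : ∀ C : Set (Fin N → EuclideanSpace ℝ (Fin m)),
      μ {w | (fun i => (w i).2) ∈ C} ≤ (Measure.pi fun _ : Fin N => stdGaussianE m) C := by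
    intro C
    rw [← hsnd.map_eq]
    exact Measure.le_map_apply hsnd.measurable.aemeasurable C
  set G := (Prod.map (fun (w : Fin N → Bool × EuclideanSpace ℝ (Fin m)) i => mcPoint c₁ c₂ (w i))
    (id : (Fin 7 → Finset (Fin N)) → _)) ⁻¹'
      {ω | kmeansVal 2 ω.1 ≤ 3 * B ∧
                   (∀ j : Fin 7, 2 * B ≤ sdpVal 2 (fun i : ↥(ω.2 j) => ω.1 i)) ∧
                   (B / ⨅ j : Fin 7, sdpVal 2 (fun i : ↥(ω.2 j) => ω.1 i)) ^ 7
                     ≤ (2 : ℝ)⁻¹ ^ 7} with hG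
  have hone : 1 ≤ (μ.prod ν) G + (μ.prod ν) Gᶜ := by
    rw [← measure_univ (μ := μ.prod ν), ← Set.union_compl_self G]
    exact measure_union_le _ _
  refine tsub_le_iff_right.2 (hone.trans ?_)
  gcongr
  -- the bad events
  set U : Set (Fin N → EuclideanSpace ℝ (Fin m)) := {g | (m + 3 : ℝ) * N ≤ ∑ i, ‖g i‖ ^ 2} with hUdef
  set V : Finset (Fin N) → Set (Fin N → EuclideanSpace ℝ (Fin m)) := fun A =>
    {g | ∑ i ∈ A, ‖g i‖ ^ 2 ≤ 4 / 5 * ((m : ℝ) * A.card)} ∪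
    {g | ((m : ℝ) * A.card / 30) ^ 2 ≤ ∑ i ∈ A, ∑ j ∈ A, (inner ℝ (g i) (g j)) ^ 2} with hVdef
  have hV : ∀ A : Finset (Fin N), A.card = s →
      μ {w | (fun i => (w i).2) ∈ V A} ≤ ENNReal.ofReal (21800 / m) := by
    intro A hA
    refine (hev _).trans ((measure_union_le _ _).trans ((add_le_add
      (mc_lower m N A (by omega) (by omega)) (mc_frob m N (by omega) A (by omega))).trans
        (le_of_eq ?_)))
    rw [← ENNReal.ofReal_add (by positivity) (by positivity)]
    congr 1
    ring
  have hsub : Gᶜ ⊆ ({w | (fun i => (w i).2) ∈ U} ×ˢ Set.univ) ∪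
      ⋃ j : Fin 7, {ω : (Fin N → Bool × EuclideanSpace ℝ (Fin m)) × (Fin 7 → Finset (Fin N)) |
        (ω.2 j).card ≠ s ∨ ω.1 ∈ {w | (fun i => (w i).2) ∈ V (ω.2 j)}} := by
    rintro ⟨w, S⟩ hw
    by_contra hnot
    apply hw
    simp only [Set.mem_union, Set.mem_iUnion, not_or, not_exists] at hnot
    obtain ⟨hU', hV'⟩ := hnot
    have hU'' : (fun i => (w i).2) ∉ U := fun h => hU' ⟨h, trivial⟩
    have hc : ∀ j, (S j).card = s := fun j => by
      by_contra h
      exact hV' j (Or.inl h)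
    have hv : ∀ j, (fun i => (w i).2) ∉ V (S j) := fun j h => hV' j (Or.inr h)
    refine mc_deterministic hm hs hms (by omega) hB c₁ c₂ w S ?_ hc (fun j => ?_) (fun j => ?_)
    · exact lt_of_not_ge hU''
    · exact lt_of_not_ge fun h => hv j (Or.inl h)
    · exact lt_of_not_ge fun h => hv j (Or.inr h)
  refine (measure_mono hsub).trans ((measure_union_le _ _).trans ?_)
  have hA1 : (μ.prod ν) ({w | (fun i => (w i).2) ∈ U} ×ˢ Set.univ) ≤ ENNReal.ofReal (1 / m) := by
    rw [Measure.prod_prod, measure_univ, mul_one]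
    exact (hev U).trans (mc_upper m N (by omega) hN)
  have hA2 : (μ.prod ν) (⋃ j : Fin 7,
      {ω : (Fin N → Bool × EuclideanSpace ℝ (Fin m)) × (Fin 7 → Finset (Fin N)) |
        (ω.2 j).card ≠ s ∨ ω.1 ∈ {w | (fun i => (w i).2) ∈ V (ω.2 j)}}) ≤
      ENNReal.ofReal (152600 / m) := by
    refine (measure_iUnion_fintype_le _ _).trans ((Finset.sum_le_sum fun j _ =>
      mc_subsample μ hsN (fun A => {w | (fun i => (w i).2) ∈ V A}) hV j).trans (le_of_eq ?_))
    rw [← ENNReal.ofReal_sum_of_nonneg (fun j _ => by positivity)]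
    congr 1
    simp
    ring
  refine (add_le_add hA1 hA2).trans (le_of_eq ?_)
  rw [← ENNReal.ofReal_add (by positivity) (by positivity)]
  congr 1
  ring
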